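/- For n ≥ 3, the number of 132-avoiding permutations of length n with exactly two descents and major index 3 equals C(n-1,2), the number with major index 4 equals C(n-1,2) - 1, and for n ≥ 5 the number with major index 5 equals n² - 4n + 1. -/

import Mathlib

open Finset Polynomial
open scoped Classical

/-- The descent set of a permutation `σ` of `{1,…,n}` (as a permutation of `Fin n`,
written in one-line notation with 1-based positions): those positions `i ∈ {1,…,n-1}`
with `σ(i) > σ(i+1)`. -/
noncomputable def permDes (n : ℕ) (σ : Equiv.Perm (Fin n)) : Finset ℕ :=
  (Finset.Ico 1 n).filter (fun i => ∀ h : i < n, σ ⟨i, h⟩ < σ ⟨i - 1, by omega⟩)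

/-- The major index: the sum of the descent positions. -/
noncomputable def permMaj (n : ℕ) (σ : Equiv.Perm (Fin n)) : ℕ := (permDes n σ).sum id

/-- `σ` avoids the pattern 321. -/
def Avoids321 {n : ℕ} (σ : Equiv.Perm (Fin n)) : Prop :=
  ¬ ∃ i j k : Fin n, i < j ∧ j < k ∧ σ k < σ j ∧ σ j < σ i

/-- `σ` avoids the pattern 132. -/
def Avoids132 {n : ℕ} (σ : Equiv.Perm (Fin n)) : Prop :=
  ¬ ∃ i j k : Fin n, i < j ∧ j < k ∧ σ i < σ k ∧ σ k < σ j

/-- `σ` avoids the pattern 231. -/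
def Avoids231 {n : ℕ} (σ : Equiv.Perm (Fin n)) : Prop :=
  ¬ ∃ i j k : Fin n, i < j ∧ j < k ∧ σ k < σ i ∧ σ i < σ j

/-- `A n i = ∑ q^{maj σ}` over 321-avoiding permutations of length `n` with exactly
`i` descents. -/
noncomputable def A (n i : ℕ) : Polynomial ℚ :=
  (Finset.univ.filter
      (fun σ : Equiv.Perm (Fin n) => Avoids321 σ ∧ (permDes n σ).card = i)).sum
    (fun σ => Polynomial.X ^ permMaj n σ)

/-- One-line notation as a function on naturals. -/
noncomputable def GG {n : ℕ} (σ : Equiv.Perm (Fin n)) (i : ℕ) : ℕ :=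
  if h : i < n then (σ ⟨i, h⟩ : ℕ) else 0

lemma GG_lt {n : ℕ} (σ : Equiv.Perm (Fin n)) {i : ℕ} (h : i < n) : GG σ i < n := by
  simp [GG, h]

lemma GG_inj {n : ℕ} (σ : Equiv.Perm (Fin n)) {i j : ℕ} (hi : i < n) (hj : j < n)
    (h : GG σ i = GG σ j) : i = j := by
  simp only [GG, hi, hj, dif_pos] at h
  have := σ.injective (Fin.ext h)
  simpa using this

lemma GG_surj {n : ℕ} (σ : Equiv.Perm (Fin n)) {v : ℕ} (hv : v < n) :
    ∃ i, i < n ∧ GG σ i = v := by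
  refine ⟨σ.symm ⟨v, hv⟩, (σ.symm ⟨v, hv⟩).2, ?_⟩
  simp [GG]

lemma avoids_iff {n : ℕ} (σ : Equiv.Perm (Fin n)) :
    Avoids132 σ ↔ ∀ i j k, i < j → j < k → k < n → GG σ i < GG σ k → GG σ k < GG σ j → False := by
  unfold Avoids132
  constructor
  · intro h i j k hij hjk hk h1 h2
    have hj : j < n := by omega
    have hi : i < n := by omega
    simp only [GG, hi, hj, hk, dif_pos] at h1 h2
    exact h ⟨⟨i, hi⟩, ⟨j, hj⟩, ⟨k, hk⟩, hij, hjk, h1, h2⟩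
  · rintro h ⟨i, j, k, hij, hjk, h1, h2⟩
    refine h i j k hij hjk k.2 ?_ ?_
    · simpa [GG] using h1
    · simpa [GG] using h2

lemma mem_des {n : ℕ} (σ : Equiv.Perm (Fin n)) (i : ℕ) :
    i ∈ permDes n σ ↔ 1 ≤ i ∧ i < n ∧ GG σ i < GG σ (i - 1) := by
  unfold permDes
  rw [Finset.mem_filter, Finset.mem_Ico]
  constructor
  · rintro ⟨⟨h1, h2⟩, h3⟩
    have h4 : i - 1 < n := by omega
    refine ⟨h1, h2, ?_⟩
    simp only [GG, h2, h4, dif_pos]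
    exact h3 h2
  · rintro ⟨h1, h2, h3⟩
    have h4 : i - 1 < n := by omega
    simp only [GG, h2, h4, dif_pos] at h3
    exact ⟨⟨h1, h2⟩, fun _ => h3⟩

/-- Increasing from position `k` on. -/
def IncF {n : ℕ} (k : ℕ) (σ : Equiv.Perm (Fin n)) : Prop :=
  ∀ i j, k ≤ i → i < j → j < n → GG σ i < GG σ j

lemma incF_of_step {n : ℕ} (k : ℕ) (σ : Equiv.Perm (Fin n))
    (h : ∀ i, k < i → i < n → ¬ GG σ i < GG σ (i - 1)) : IncF k σ := by
  intro i j hi hij hj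
  induction j with
  | zero => omega
  | succ j ih =>
    have h1 := h (j + 1) (by omega) hj
    have h2 : GG σ (j + 1) ≠ GG σ j := fun e => by
      have := GG_inj σ hj (by omega) e
      omega
    simp only [Nat.add_sub_cancel] at h1
    rcases Nat.lt_succ_iff_lt_or_eq.mp hij with h3 | h3
    · have := ih h3 (by omega)
      omega
    · subst h3; omega

lemma exists_perm {n k : ℕ} (hk : k ≤ n) (p : ℕ → ℕ) (hp : ∀ i, i < k → p i < n)
    (hinj : ∀ i j, i < j → j < k → p i ≠ p j) :
    ∃ σ : Equiv.Perm (Fin n), IncF k σ ∧ ∀ i, i < k → GG σ i = p i := by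
  have hinj' : Set.InjOn p (Finset.range k : Set ℕ) := by
    intro i hi j hj h
    simp only [Finset.coe_range, Set.mem_Iio] at hi hj
    rcases lt_trichotomy i j with h1 | h1 | h1
    · exact absurd h (hinj i j h1 hj)
    · exact h1
    · exact absurd h.symm (hinj j i h1 hi)
  set S : Finset ℕ := Finset.range n \ (Finset.range k).image p with hS
  have hsub : (Finset.range k).image p ⊆ Finset.range n := by
    intro x hx
    simp only [Finset.mem_image, Finset.mem_range] at hx ⊢
    obtain ⟨i, hi, rfl⟩ := hx
    exact hp i hi
  have hcard : S.card = n - k := by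
    rw [hS, Finset.card_sdiff_of_subset hsub, Finset.card_image_of_injOn hinj']
    simp
  let e := S.orderEmbOfFin hcard
  have heS : ∀ i, e i ∈ S := fun i => Finset.orderEmbOfFin_mem S hcard i
  let f : Fin n → Fin n := fun i =>
    if h : (i : ℕ) < k then ⟨p i, hp i h⟩
    else ⟨e ⟨i - k, by omega⟩, by
      have := heS ⟨i - k, by omega⟩
      rw [hS, Finset.mem_sdiff, Finset.mem_range] at this
      exact this.1⟩
  have hnot : ∀ i, i < k → ∀ j, e j ≠ p i := by
    intro i hi j h
    have := heS j
    rw [hS, Finset.mem_sdiff] at this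
    exact this.2 (Finset.mem_image.mpr ⟨i, Finset.mem_range.mpr hi, h.symm⟩)
  have hf : Function.Injective f := by
    intro i j h
    by_cases hi : (i : ℕ) < k <;> by_cases hj : (j : ℕ) < k
    · simp only [f, hi, hj, dif_pos, Fin.mk.injEq] at h
      exact Fin.ext (hinj' (by simpa using hi) (by simpa using hj) h)
    · simp only [f, hi, hj, dif_pos, dif_neg, not_false_eq_true, Fin.mk.injEq] at h
      exact absurd h.symm (hnot _ hi _)
    · simp only [f, hi, hj, dif_pos, dif_neg, not_false_eq_true, Fin.mk.injEq] at h
      exact absurd h (hnot _ hj _)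
    · simp only [f, hi, hj, dif_neg, not_false_eq_true, Fin.mk.injEq] at h
      have := e.injective h
      simp only [Fin.mk.injEq] at this
      exact Fin.ext (by omega)
  refine ⟨Equiv.ofBijective f (Finite.injective_iff_bijective.mp hf), ?_, ?_⟩
  · intro i j hi hij hj
    have hi' : i < n := by omega
    have h1 : ¬ i < k := by omega
    have h2 : ¬ j < k := by omega
    simp only [GG, hi', hj, dif_pos, Equiv.ofBijective_apply, f, h1, h2, dif_neg,
      not_false_eq_true]
    apply e.strictMono
    simp only [Fin.mk_lt_mk]
    omega
  · intro i hi
    have hi' : i < n := by omega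
    simp [GG, hi', f, hi]

lemma perm_unique {n k : ℕ} (σ τ : Equiv.Perm (Fin n)) (hσ : IncF k σ) (hτ : IncF k τ)
    (h : ∀ i, i < k → GG σ i = GG τ i) : σ = τ := by
  have key : ∀ i, i < n → GG σ i = GG τ i := by
    intro i
    induction i using Nat.strong_induction_on with
    | _ i ih =>
      intro hi
      by_cases hik : i < k
      · exact h i hik
      -- first disagreement leads to a contradiction
      have aux : ∀ (α β : Equiv.Perm (Fin n)), IncF k α → IncF k β →
          (∀ m, m < i → m < n → GG α m = GG β m) → ¬ GG α i < GG β i := by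
        intro α β hα hβ hm hlt
        obtain ⟨j, hj, hje⟩ := GG_surj β (GG_lt α hi)
        rcases lt_trichotomy j i with h1 | h1 | h1
        · have := hm j h1 hj
          have := GG_inj α hj hi (by omega)
          omega
        · subst h1; omega
        · have := hβ i j (by omega) h1 hj
          omega
      have h1 := aux σ τ hσ hτ ih
      have h2 := aux τ σ hτ hσ (fun m a b => (ih m a b).symm)
      omega
  ext i
  have := key i i.2
  simpa [GG] using this

lemma count_generic {n k x y : ℕ} (hk : k ≤ n) (hx : x < k) (hy : y < k)
    (E : Finset (ℕ × ℕ)) (D : Finset ℕ) (p : ℕ → ℕ → ℕ → ℕ)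
    (hE : ∀ a c, (a, c) ∈ E → (∀ i, i < k → p a c i < n) ∧
      (∀ i j, i < j → j < k → p a c i ≠ p a c j) ∧ p a c x = a ∧ p a c y = c)
    (fwd : ∀ σ : Equiv.Perm (Fin n), Avoids132 σ → permDes n σ = D →
      (GG σ x, GG σ y) ∈ E ∧ IncF k σ ∧ ∀ i, i < k → GG σ i = p (GG σ x) (GG σ y) i)
    (bwd : ∀ a c, (a, c) ∈ E → ∀ σ : Equiv.Perm (Fin n), IncF k σ →
      (∀ i, i < k → GG σ i = p a c i) → Avoids132 σ ∧ permDes n σ = D) :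
    (Finset.univ.filter (fun σ : Equiv.Perm (Fin n) => Avoids132 σ ∧ permDes n σ = D)).card
      = E.card := by
  apply Finset.card_bij (fun σ _ => (GG σ x, GG σ y))
  · intro σ hσ
    simp only [Finset.mem_filter, Finset.mem_univ, true_and] at hσ
    exact (fwd σ hσ.1 hσ.2).1
  · intro σ hσ τ hτ h
    simp only [Finset.mem_filter, Finset.mem_univ, true_and] at hσ hτ
    obtain ⟨_, h1, h2⟩ := fwd σ hσ.1 hσ.2
    obtain ⟨_, h3, h4⟩ := fwd τ hτ.1 hτ.2
    simp only [Prod.mk.injEq] at h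
    refine perm_unique σ τ h1 h3 fun i hi => ?_
    rw [h2 i hi, h4 i hi, h.1, h.2]
  · rintro ⟨a, c⟩ he
    obtain ⟨h1, h2, h3, h4⟩ := hE a c he
    obtain ⟨σ, h5, h6⟩ := exists_perm hk (p a c) h1 h2
    refine ⟨σ, ?_, ?_⟩
    · simp only [Finset.mem_filter, Finset.mem_univ, true_and]
      exact bwd a c he σ h5 h6
    · rw [h6 x hx, h6 y hy, h3, h4]

lemma des_iff {n u v : ℕ} (σ : Equiv.Perm (Fin n)) :
    permDes n σ = {u, v} ↔
      ∀ i, (1 ≤ i ∧ i < n ∧ GG σ i < GG σ (i - 1)) ↔ (i = u ∨ i = v) := by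
  rw [Finset.ext_iff]
  simp only [mem_des, Finset.mem_insert, Finset.mem_singleton]

/-- The set of pairs parametrizing the permutations. -/
def EE (n d : ℕ) : Finset (ℕ × ℕ) :=
  (Finset.range n ×ˢ Finset.range n).filter (fun e => 1 ≤ e.1 ∧ e.1 < e.2 ∧ e.1 + d < n)

lemma mem_EE {n d a c : ℕ} : (a, c) ∈ EE n d ↔ 1 ≤ a ∧ a < c ∧ c < n ∧ a + d < n := by
  simp only [EE, Finset.mem_filter, Finset.mem_product, Finset.mem_range]
  omega

lemma card_EE (m d : ℕ) (hd : 1 ≤ d) : 2 * (EE (m + 1 + d) d).card = 2 * m * d + m * (m - 1) := by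
  have h1 : (EE (m + 1 + d) d).card
      = ((Finset.range m).sigma (fun a => Finset.range (m + d - 1 - a))).card := by
    symm
    apply Finset.card_bij (fun e _ => (e.1 + 1, e.1 + 2 + e.2))
    · rintro ⟨a, b⟩ h
      simp only [Finset.mem_sigma, Finset.mem_range] at h
      rw [mem_EE]; dsimp only; omega
    · rintro ⟨a, b⟩ h ⟨a', b'⟩ h' e
      simp only [Prod.mk.injEq] at e
      obtain ⟨e1, e2⟩ := e
      have : a = a' := by omega
      subst this
      have : b = b' := by omega
      subst this
      rfl
    · rintro ⟨a, c⟩ h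
      rw [mem_EE] at h
      refine ⟨⟨a - 1, c - a - 1⟩, ?_, ?_⟩
      · simp only [Finset.mem_sigma, Finset.mem_range]; omega
      · simp only [Prod.mk.injEq]; omega
  rw [h1, Finset.card_sigma]
  simp only [Finset.card_range]
  have h2 : ∑ a ∈ Finset.range m, (m + d - 1 - a) = ∑ a ∈ Finset.range m, (d + a) := by
    rw [← Finset.sum_range_reflect (fun a => d + a) m]
    apply Finset.sum_congr rfl
    intro a ha
    rw [Finset.mem_range] at ha
    omega
  rw [h2, Finset.sum_add_distrib, Finset.sum_const, Finset.card_range, smul_eq_mul, mul_add,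
    ← Finset.sum_range_id_mul_two]
  ring

lemma two_choose (m : ℕ) : 2 * Nat.choose m 2 = m * (m - 1) := by
  rw [Nat.choose_two_right]
  exact Nat.mul_div_cancel' (Nat.even_mul_pred_self m).two_dvd

/-- In the backward direction: the value zero sits at position `k`. -/
lemma zero_at {n k : ℕ} (hn : 0 < n) (σ : Equiv.Perm (Fin n)) (h : IncF k σ)
    (h0 : ∀ i, i < k → GG σ i ≠ 0) : k < n ∧ GG σ k = 0 := by
  obtain ⟨j, hj, hje⟩ := GG_surj σ hn
  have hkj : k ≤ j := by
    by_contra hc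
    exact h0 j (by omega) hje
  refine ⟨by omega, ?_⟩
  rcases Nat.eq_or_lt_of_le hkj with h1 | h1
  · rw [h1]; exact hje
  · have := h k j le_rfl h1 hj
    omega

lemma count12 {n : ℕ} (hn : 3 ≤ n) :
    (Finset.univ.filter (fun σ : Equiv.Perm (Fin n) => Avoids132 σ ∧ permDes n σ = {1, 2})).card
      = (EE n 1).card := by
  apply count_generic (k := 2) (x := 1) (y := 0) (by omega) (by omega) (by omega) _ _
    (fun a c i => if i = 0 then c else a)
  · intro a c h
    rw [mem_EE] at h
    refine ⟨?_, ?_, by simp, by simp⟩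
    · intro i hi; split_ifs <;> omega
    · intro i j hi hj; split_ifs <;> omega
  · intro σ hav hdes
    rw [des_iff] at hdes
    have d1 := (hdes 1).mpr (by omega)
    have d2 := (hdes 2).mpr (by omega)
    have b0 := GG_lt σ (i := 0) (by omega)
    norm_num at d1 d2
    refine ⟨?_, ?_, ?_⟩
    · rw [mem_EE]; omega
    · apply incF_of_step
      intro i hi hin hlt
      have := (hdes i).mp ⟨by omega, hin, hlt⟩
      omega
    · intro i hi
      interval_cases i <;> simp
  · intro a c h σ hinc hp
    rw [mem_EE] at h
    have p0 := hp 0 (by omega)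
    have p1 := hp 1 (by omega)
    norm_num at p0 p1
    obtain ⟨hkn, hz⟩ := zero_at (by omega) σ hinc (by
      intro i hi; interval_cases i <;> omega)
    constructor
    · rw [avoids_iff]
      intro i j l hij hjl hl h1 h2
      by_cases hj : 2 ≤ j
      · have := hinc j l hj hjl hl
        omega
      · obtain rfl : j = 1 := by omega
        obtain rfl : i = 0 := by omega
        omega
    · rw [des_iff]
      intro i
      constructor
      · rintro ⟨h1, h2, h3⟩
        by_contra hc
        have := hinc (i - 1) i (by omega) (by omega) h2
        omega
      · rintro (rfl | rfl)
        · norm_num; omega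
        · norm_num; omega

lemma count13 {n : ℕ} (hn : 3 ≤ n) :
    (Finset.univ.filter (fun σ : Equiv.Perm (Fin n) => Avoids132 σ ∧ permDes n σ = {1, 3})).card
      = (EE n 2).card := by
  apply count_generic (k := 3) (x := 1) (y := 0) (by omega) (by omega) (by omega) _ _
    (fun a c i => if i = 0 then c else if i = 1 then a else if c = a + 1 then a + 2 else a + 1)
  · intro a c h
    rw [mem_EE] at h
    refine ⟨?_, ?_, by simp, by simp⟩
    · intro i hi; split_ifs <;> omega
    · intro i j hi hj; split_ifs <;> omega
  · intro σ hav hdes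
    rw [des_iff] at hdes
    rw [avoids_iff] at hav
    have d1 := (hdes 1).mpr (by omega)
    have d3 := (hdes 3).mpr (by omega)
    have d2 := mt (hdes 2).mp (by omega)
    have b0 := GG_lt σ (i := 0) (by omega)
    have b2 := GG_lt σ (i := 2) (by omega)
    have i12 : GG σ 1 ≠ GG σ 2 := fun e => by
      have := GG_inj σ (by omega) (by omega) e
      omega
    have i02 : GG σ 0 ≠ GG σ 2 := fun e => by
      have := GG_inj σ (by omega) (by omega) e
      omega
    have i13 : GG σ 1 ≠ GG σ 3 := fun e => by
      have := GG_inj σ (by omega) (by omega) e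
      omega
    norm_num at d1 d2 d3
    have d2' := d2 (by omega)
    have a3 : ¬ (GG σ 1 < GG σ 3 ∧ GG σ 3 < GG σ 2) :=
      fun h => hav 1 2 3 (by omega) (by omega) (by omega) h.1 h.2
    have btw : ∀ v, (GG σ 1 < v ∧ v < GG σ 2) → v = GG σ 0 := by
      rintro v ⟨h1, h2⟩
      obtain ⟨j, hj, hje⟩ := GG_surj σ (v := v) (by omega)
      by_cases hj3 : 3 ≤ j
      · exact (hav 1 2 j (by omega) (by omega) hj (by omega) (by omega)).elim
      · interval_cases j <;> omega
    have e1 := btw (GG σ 1 + 1)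
    have e2 := btw (GG σ 1 + 2)
    refine ⟨?_, ?_, ?_⟩
    · rw [mem_EE]; omega
    · apply incF_of_step
      intro i hi hin hlt
      have := (hdes i).mp ⟨by omega, hin, hlt⟩
      omega
    · intro i hi
      interval_cases i
      · simp
      · simp
      · norm_num; split_ifs <;> omega
  · intro a c h σ hinc hp
    rw [mem_EE] at h
    have p0 := hp 0 (by omega)
    have p1 := hp 1 (by omega)
    have p2 := hp 2 (by omega)
    norm_num at p0 p1 p2
    have p2' : (c = a + 1 ∧ GG σ 2 = a + 2) ∨ (c ≠ a + 1 ∧ GG σ 2 = a + 1) := by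
      split_ifs at p2 <;> omega
    clear p2
    obtain ⟨hkn, hz⟩ := zero_at (by omega) σ hinc (by
      intro i hi; interval_cases i <;> omega)
    constructor
    · rw [avoids_iff]
      intro i j l hij hjl hl h1 h2
      by_cases hj : 3 ≤ j
      · have := hinc j l hj hjl hl
        omega
      · have l0 : GG σ l ≠ GG σ 0 := fun e => by
          have := GG_inj σ (by omega) (by omega) e
          omega
        interval_cases j <;> interval_cases i <;> omega
    · rw [des_iff]
      intro i
      constructor
      · rintro ⟨h1, h2, h3⟩
        by_contra hc
        by_cases hi : i = 2
        · subst hi; norm_num at h3; omega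
        · have := hinc (i - 1) i (by omega) (by omega) h2
          omega
      · rintro (rfl | rfl)
        · norm_num; omega
        · norm_num; omega

lemma count23 {n : ℕ} (hn : 3 ≤ n) :
    (Finset.univ.filter (fun σ : Equiv.Perm (Fin n) => Avoids132 σ ∧ permDes n σ = {2, 3})).card
      = (EE (n - 1) 1).card := by
  apply count_generic (k := 3) (x := 2) (y := 0) (by omega) (by omega) (by omega) _ _
    (fun a c i => if i = 0 then c else if i = 1 then c + 1 else a)
  · intro a c h
    rw [mem_EE] at h
    refine ⟨?_, ?_, by simp, by simp⟩
    · intro i hi; split_ifs <;> omega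
    · intro i j hi hj; split_ifs <;> omega
  · intro σ hav hdes
    rw [des_iff] at hdes
    rw [avoids_iff] at hav
    have d2 := (hdes 2).mpr (by omega)
    have d3 := (hdes 3).mpr (by omega)
    have d1 := mt (hdes 1).mp (by omega)
    have b1 := GG_lt σ (i := 1) (by omega)
    have i01 : GG σ 0 ≠ GG σ 1 := fun e => by
      have := GG_inj σ (by omega) (by omega) e
      omega
    have i02 : GG σ 0 ≠ GG σ 2 := fun e => by
      have := GG_inj σ (by omega) (by omega) e
      omega
    norm_num at d1 d2 d3
    have d1' := d1 (by omega)
    have a2 : ¬ (GG σ 0 < GG σ 2 ∧ GG σ 2 < GG σ 1) :=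
      fun h => hav 0 1 2 (by omega) (by omega) (by omega) h.1 h.2
    have e1 : ¬ (GG σ 0 + 1 < GG σ 1) := by
      intro h2
      obtain ⟨j, hj, hje⟩ := GG_surj σ (v := GG σ 0 + 1) (by omega)
      by_cases hj3 : 2 ≤ j
      · exact (hav 0 1 j (by omega) (by omega) hj (by omega) (by omega)).elim
      · interval_cases j <;> omega
    refine ⟨?_, ?_, ?_⟩
    · rw [mem_EE]; omega
    · apply incF_of_step
      intro i hi hin hlt
      have := (hdes i).mp ⟨by omega, hin, hlt⟩
      omega
    · intro i hi
      interval_cases i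
      · simp
      · norm_num; omega
      · simp
  · intro a c h σ hinc hp
    rw [mem_EE] at h
    have p0 := hp 0 (by omega)
    have p1 := hp 1 (by omega)
    have p2 := hp 2 (by omega)
    norm_num at p0 p1 p2
    obtain ⟨hkn, hz⟩ := zero_at (by omega) σ hinc (by
      intro i hi; interval_cases i <;> omega)
    constructor
    · rw [avoids_iff]
      intro i j l hij hjl hl h1 h2
      by_cases hj : 3 ≤ j
      · have := hinc j l hj hjl hl
        omega
      · interval_cases j <;> interval_cases i <;> omega
    · rw [des_iff]
      intro i
      constructor
      · rintro ⟨h1, h2, h3⟩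
        by_contra hc
        by_cases hi : i = 1
        · subst hi; norm_num at h3; omega
        · have := hinc (i - 1) i (by omega) (by omega) h2
          omega
      · rintro (rfl | rfl)
        · norm_num; omega
        · norm_num; omega

lemma count14 {n : ℕ} (hn : 4 ≤ n) :
    (Finset.univ.filter (fun σ : Equiv.Perm (Fin n) => Avoids132 σ ∧ permDes n σ = {1, 4})).card
      = (EE n 3).card := by
  apply count_generic (k := 4) (x := 1) (y := 0) (by omega) (by omega) (by omega) _ _
    (fun a c i => if i = 0 then c else if i = 1 then a else if i = 2 then
      (if c = a + 1 then a + 2 else a + 1) else (if c ≤ a + 2 then a + 3 else a + 2))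
  · intro a c h
    rw [mem_EE] at h
    refine ⟨?_, ?_, by simp, by simp⟩
    · intro i hi; split_ifs <;> omega
    · intro i j hi hj; split_ifs <;> omega
  · intro σ hav hdes
    rw [des_iff] at hdes
    rw [avoids_iff] at hav
    have d1 := (hdes 1).mpr (by omega)
    have d4 := (hdes 4).mpr (by omega)
    have d2 := mt (hdes 2).mp (by omega)
    have d3 := mt (hdes 3).mp (by omega)
    have b0 := GG_lt σ (i := 0) (by omega)
    have b3 := GG_lt σ (i := 3) (by omega)
    have inj : ∀ i j, i < j → j < n → GG σ i ≠ GG σ j := fun i j hij hj e => by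
      have := GG_inj σ (by omega) (by omega) e
      omega
    have i12 := inj 1 2 (by omega) (by omega)
    have i23 := inj 2 3 (by omega) (by omega)
    have i02 := inj 0 2 (by omega) (by omega)
    have i03 := inj 0 3 (by omega) (by omega)
    have i14 := inj 1 4 (by omega) (by omega)
    norm_num at d1 d2 d3 d4
    have d2' := d2 (by omega)
    have d3' := d3 (by omega)
    have a3 : ¬ (GG σ 1 < GG σ 4 ∧ GG σ 4 < GG σ 3) :=
      fun h => hav 1 3 4 (by omega) (by omega) (by omega) h.1 h.2
    have btw : ∀ v, (GG σ 1 < v ∧ v < GG σ 3) → v = GG σ 0 ∨ v = GG σ 2 := by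
      rintro v ⟨h1, h2⟩
      obtain ⟨j, hj, hje⟩ := GG_surj σ (v := v) (by omega)
      by_cases hj3 : 4 ≤ j
      · exact (hav 1 3 j (by omega) (by omega) hj (by omega) (by omega)).elim
      · interval_cases j <;> omega
    have e1 := btw (GG σ 1 + 1)
    have e2 := btw (GG σ 1 + 2)
    have e3 := btw (GG σ 1 + 3)
    refine ⟨?_, ?_, ?_⟩
    · rw [mem_EE]; omega
    · apply incF_of_step
      intro i hi hin hlt
      have := (hdes i).mp ⟨by omega, hin, hlt⟩
      omega
    · intro i hi
      interval_cases i
      · simp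
      · simp
      · norm_num; split_ifs <;> omega
      · norm_num; split_ifs <;> omega
  · intro a c h σ hinc hp
    rw [mem_EE] at h
    have p0 := hp 0 (by omega)
    have p1 := hp 1 (by omega)
    have p2 := hp 2 (by omega)
    have p3 := hp 3 (by omega)
    norm_num at p0 p1 p2 p3
    have p2' : (c = a + 1 ∧ GG σ 2 = a + 2) ∨ (c ≠ a + 1 ∧ GG σ 2 = a + 1) := by
      split_ifs at p2 <;> omega
    have p3' : (c ≤ a + 2 ∧ GG σ 3 = a + 3) ∨ (a + 2 < c ∧ GG σ 3 = a + 2) := by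
      split_ifs at p3 <;> omega
    clear p2 p3
    obtain ⟨hkn, hz⟩ := zero_at (by omega) σ hinc (by
      intro i hi; interval_cases i <;> omega)
    constructor
    · rw [avoids_iff]
      intro i j l hij hjl hl h1 h2
      by_cases hj : 4 ≤ j
      · have := hinc j l hj hjl hl
        omega
      · have l0 : GG σ l ≠ GG σ 0 := fun e => by
          have := GG_inj σ (by omega) (by omega) e
          omega
        by_cases l3 : l = 3
        · subst l3
          interval_cases j <;> interval_cases i <;> omega
        · have l2 : j < 2 ∨ GG σ l ≠ GG σ 2 := by
            by_contra! hc
            have := GG_inj σ (by omega) (by omega) hc.2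
            omega
          interval_cases j <;> interval_cases i <;> omega
    · rw [des_iff]
      intro i
      constructor
      · rintro ⟨h1, h2, h3⟩
        by_contra hc
        by_cases hi : i = 2
        · subst hi; norm_num at h3; omega
        by_cases hi : i = 3
        · subst hi; norm_num at h3; omega
        · have := hinc (i - 1) i (by omega) (by omega) h2
          omega
      · rintro (rfl | rfl)
        · norm_num; omega
        · norm_num; omega

lemma two_elts {n : ℕ} (σ : Equiv.Perm (Fin n)) (h : (permDes n σ).card = 2) :
    ∃ x y, 1 ≤ x ∧ x < y ∧ permDes n σ = {x, y} ∧ permMaj n σ = x + y := by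
  obtain ⟨x, y, hxy, he⟩ := Finset.card_eq_two.mp h
  have hx := ((mem_des σ x).mp (by rw [he]; simp)).1
  have hy := ((mem_des σ y).mp (by rw [he]; simp)).1
  have hs : permMaj n σ = x + y := by
    unfold permMaj
    rw [he, Finset.sum_pair hxy]
    rfl
  rcases lt_or_gt_of_ne hxy with h1 | h1
  · exact ⟨x, y, hx, h1, he, hs⟩
  · exact ⟨y, x, hy, h1, by rw [he, Finset.pair_comm], by omega⟩

lemma of_pair {n x y : ℕ} (σ : Equiv.Perm (Fin n)) (hxy : x ≠ y) (h : permDes n σ = {x, y}) :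
    (permDes n σ).card = 2 ∧ permMaj n σ = x + y := by
  refine ⟨by rw [h, Finset.card_pair hxy], ?_⟩
  unfold permMaj
  rw [h, Finset.sum_pair hxy]
  rfl

lemma maj3 {n : ℕ} (σ : Equiv.Perm (Fin n)) :
    ((permDes n σ).card = 2 ∧ permMaj n σ = 3) ↔ permDes n σ = {1, 2} := by
  constructor
  · rintro ⟨h, h'⟩
    obtain ⟨x, y, h1, h2, h3, h4⟩ := two_elts σ h
    obtain ⟨rfl, rfl⟩ : x = 1 ∧ y = 2 := by omega
    exact h3
  · exact fun h => of_pair σ (by omega) h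

lemma maj4 {n : ℕ} (σ : Equiv.Perm (Fin n)) :
    ((permDes n σ).card = 2 ∧ permMaj n σ = 4) ↔ permDes n σ = {1, 3} := by
  constructor
  · rintro ⟨h, h'⟩
    obtain ⟨x, y, h1, h2, h3, h4⟩ := two_elts σ h
    obtain ⟨rfl, rfl⟩ : x = 1 ∧ y = 3 := by omega
    exact h3
  · exact fun h => of_pair σ (by omega) h

lemma maj5 {n : ℕ} (σ : Equiv.Perm (Fin n)) :
    ((permDes n σ).card = 2 ∧ permMaj n σ = 5) ↔
      (permDes n σ = {1, 4} ∨ permDes n σ = {2, 3}) := by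
  constructor
  · rintro ⟨h, h'⟩
    obtain ⟨x, y, h1, h2, h3, h4⟩ := two_elts σ h
    obtain ⟨rfl, rfl⟩ | ⟨rfl, rfl⟩ : (x = 1 ∧ y = 4) ∨ (x = 2 ∧ y = 3) := by omega
    · exact Or.inl h3
    · exact Or.inr h3
  · rintro (h | h)
    · exact of_pair σ (by omega) h
    · exact of_pair σ (by omega) h

/-- Counts of 132-avoiding permutations of length `n` with exactly two descents by major
index: `C(n-1,2)` with major index 3, `C(n-1,2) - 1` with major index 4 (for `n ≥ 3`),
and `n² - 4n + 1` with major index 5 (for `n ≥ 5`). -/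
theorem count_132_two_descents (n : ℕ) (hn : 3 ≤ n) :
    (Finset.univ.filter
        (fun σ : Equiv.Perm (Fin n) =>
          Avoids132 σ ∧ (permDes n σ).card = 2 ∧ permMaj n σ = 3)).card
        = Nat.choose (n - 1) 2 ∧
      (Finset.univ.filter
          (fun σ : Equiv.Perm (Fin n) =>
            Avoids132 σ ∧ (permDes n σ).card = 2 ∧ permMaj n σ = 4)).card
        = Nat.choose (n - 1) 2 - 1 ∧
      (5 ≤ n →
        (Finset.univ.filter
            (fun σ : Equiv.Perm (Fin n) =>
              Avoids132 σ ∧ (permDes n σ).card = 2 ∧ permMaj n σ = 5)).card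
          = n ^ 2 - 4 * n + 1) := by
  refine ⟨?_, ?_, ?_⟩
  · simp only [maj3]
    rw [count12 hn]
    obtain ⟨m, rfl⟩ : ∃ m, n = m + 1 + 1 := ⟨n - 2, by omega⟩
    have h1 := card_EE m 1 le_rfl
    have h2 := two_choose (m + 1)
    simp only [Nat.add_sub_cancel] at h2 ⊢
    obtain ⟨t, rfl⟩ : ∃ t, m = t + 1 := ⟨m - 1, by omega⟩
    simp only [Nat.add_sub_cancel] at h1
    nlinarith
  · simp only [maj4]
    rw [count13 hn]
    obtain ⟨t, rfl⟩ : ∃ t, n = t + 1 + 2 := ⟨n - 3, by omega⟩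
    have h1 := card_EE t 2 (by omega)
    have h2 := two_choose (t + 2)
    have e : t + 1 + 2 - 1 = t + 2 := by omega
    have e' : t + 2 - 1 = t + 1 := by omega
    rw [e'] at h2
    rw [e]
    rcases t with _ | t
    · simp at h1 h2 ⊢
      omega
    · simp only [Nat.add_sub_cancel] at h1
      have : (EE (t + 1 + 1 + 2) 2).card + 1 = (t + 1 + 2).choose 2 := by nlinarith
      omega
  · intro hn5
    simp only [maj5, and_or_left]
    rw [Finset.filter_or, Finset.card_union_of_disjoint, count14 (by omega), count23 hn]
    · obtain ⟨t, rfl⟩ : ∃ t, n = (t + 1) + 1 + 3 := ⟨n - 5, by omega⟩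
      have h1 := card_EE (t + 1) 3 (by omega)
      have h2 := card_EE (t + 1 + 1) 1 (by omega)
      have e : t + 1 + 1 + 3 - 1 = t + 1 + 1 + 1 + 1 := by omega
      rw [e]
      simp only [Nat.add_sub_cancel] at h1 h2
      have e2 : (t + 1 + 1 + 3) ^ 2 - 4 * (t + 1 + 1 + 3) = t ^ 2 + 6 * t + 5 := by
        apply Nat.sub_eq_of_eq_add
        ring
      rw [e2]
      nlinarith
    · rw [Finset.disjoint_filter]
      rintro σ - ⟨_, h1⟩ ⟨_, h2⟩
      rw [h1] at h2
      exact absurd h2 (by decide)
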